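/- arXiv:2101.02355 — 6 statements merged into one kernel-verified Lean document; each statement's English description precedes it below -/
import Mathlib

section
/- Let n be a positive integer, let a < b be real numbers, let f : ℝ → ℝ be continuous on [a,b], and let x ∈ (a,b]. Then the fractional integral expression (1/Γ(n−α)) ∫_a^x (x−s)^{n−1−α} f(s) ds tends to f(x) as α tends to n from the left (i.e., as α → n with α ∈ (n−1,n)). -/
open Filter Topology in
/-- The approximate identity on `[0, L]`. -/
lemma approx_identity_aux (L : ℝ) (hL : 0 < L) (g : ℝ → ℝ)
    (hg : ContinuousOn g (Set.Icc 0 L)) :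
    Tendsto (fun ε : ℝ => ε * ∫ t in (0:ℝ)..L, t ^ (ε - 1) * g t) (𝓝[>] 0) (𝓝 (g 0)) := by
  have hgu : ContinuousOn g (Set.uIcc 0 L) := by rwa [Set.uIcc_of_le hL.le]
  have hid : Tendsto (fun ε : ℝ => ε) (𝓝[>] 0) (𝓝 0) := tendsto_id.mono_left nhdsWithin_le_nhds
  have hLpow : Tendsto (fun ε : ℝ => L ^ ε) (𝓝[>] 0) (𝓝 1) := by
    have := (Real.continuousAt_const_rpow (b := 0) hL.ne').tendsto
    rw [Real.rpow_zero] at this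
    exact this.comp hid
  have hint : ∀ ε : ℝ, 0 < ε → IntervalIntegrable (fun t : ℝ => t ^ (ε - 1))
      MeasureTheory.volume 0 L := fun ε hε =>
    intervalIntegral.intervalIntegrable_rpow' (by linarith)
  have hval : ∀ ε : ℝ, 0 < ε → ε * ∫ t in (0:ℝ)..L, t ^ (ε - 1) = L ^ ε := by
    intro ε hε
    rw [integral_rpow (Or.inl (by linarith)), sub_add_cancel, Real.zero_rpow hε.ne']
    field_simp
    ring
  have hval1 : ∀ ε : ℝ, 0 < ε → ∫ t in (0:ℝ)..L, t ^ (ε - 1) * t = L ^ (ε + 1) / (ε + 1) := by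
    intro ε hε
    have : ∫ t in (0:ℝ)..L, t ^ (ε - 1) * t = ∫ t in (0:ℝ)..L, t ^ ε := by
      apply intervalIntegral.integral_congr_ae
      refine Filter.Eventually.of_forall fun t ht => ?_
      rw [Set.uIoc_of_le hL.le] at ht
      have h0 : 0 < t := ht.1
      have := Real.rpow_add_one h0.ne' (ε - 1)
      rw [← this, sub_add_cancel]
    rw [this, integral_rpow (Or.inl (by linarith)), Real.zero_rpow (by linarith), sub_zero]
  -- the remainder
  have hrem : Tendsto (fun ε : ℝ => ε * ∫ t in (0:ℝ)..L, t ^ (ε - 1) * (g t - g 0))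
      (𝓝[>] 0) (𝓝 0) := by
    rw [Metric.tendsto_nhds]
    intro η hη
    obtain ⟨C, hC0, hC⟩ : ∃ C : ℝ, 0 ≤ C ∧ ∀ t ∈ Set.Icc 0 L, |g t - g 0| ≤ η / 2 + C * t := by
      obtain ⟨M, hM⟩ := isCompact_Icc.exists_bound_of_continuousOn
        (hg.sub (continuousOn_const (c := g 0)))
      have hM0 : 0 ≤ M := (norm_nonneg _).trans (hM 0 ⟨le_rfl, hL.le⟩)
      obtain ⟨δ, hδ, hd⟩ := Metric.continuousOn_iff.1 hg 0 ⟨le_rfl, hL.le⟩ (η / 2) (by linarith)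
      refine ⟨M / δ, by positivity, fun t ht => ?_⟩
      have ht0 := ht.1
      by_cases h : t < δ
      · have := hd t ht (by rw [Real.dist_eq, sub_zero, abs_of_nonneg ht.1]; exact h)
        rw [Real.dist_eq] at this
        have : 0 ≤ M / δ * t := by positivity
        linarith
      · have h1 := hM t ht
        simp only [Real.norm_eq_abs, Pi.sub_apply] at h1
        have : M ≤ M / δ * t := by
          rw [div_mul_eq_mul_div, le_div_iff₀ hδ]
          exact mul_le_mul_of_nonneg_left (not_lt.1 h) hM0
        linarith
    have hlim : Tendsto (fun ε : ℝ => η / 2 * L ^ ε + C * (ε * (L ^ ε * L / (ε + 1))))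
        (𝓝[>] 0) (𝓝 (η / 2 * 1 + C * (0 * (1 * L / (0 + 1))))) :=
      (hLpow.const_mul _).add ((hid.mul ((hLpow.mul_const L).div
        (hid.add_const 1) (by norm_num))).const_mul C)
    have hlt := hlim.eventually_lt_const (u := η) (by linarith)
    filter_upwards [hlt, self_mem_nhdsWithin] with ε h1 hε
    have hε : 0 < ε := hε
    rw [Real.dist_eq, sub_zero, abs_mul, abs_of_pos hε]
    refine lt_of_le_of_lt ?_ h1
    have hb : |∫ t in (0:ℝ)..L, t ^ (ε - 1) * (g t - g 0)| ≤
        ∫ t in (0:ℝ)..L, (η / 2 * t ^ (ε - 1) + C * (t ^ (ε - 1) * t)) := by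
      rw [← Real.norm_eq_abs]
      refine intervalIntegral.norm_integral_le_of_norm_le hL.le
        (Filter.Eventually.of_forall fun t ht => ?_) ?_
      · have hp : 0 ≤ t ^ (ε - 1) := Real.rpow_nonneg ht.1.le _
        rw [Real.norm_eq_abs, abs_mul, abs_of_nonneg hp]
        have := mul_le_mul_of_nonneg_left (hC t ⟨ht.1.le, ht.2⟩) hp
        linarith
      · exact ((hint ε hε).const_mul _).add
          (((hint ε hε).mul_continuousOn (g := fun t : ℝ => t) continuousOn_id).const_mul _)
    rw [intervalIntegral.integral_add ((hint ε hε).const_mul _)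
      (((hint ε hε).mul_continuousOn (g := fun t : ℝ => t) continuousOn_id).const_mul _),
      intervalIntegral.integral_const_mul, intervalIntegral.integral_const_mul,
      hval1 ε hε, Real.rpow_add_one hL.ne'] at hb
    have := mul_le_mul_of_nonneg_left hb hε.le
    have h2 := hval ε hε
    refine this.trans (le_of_eq ?_)
    rw [← h2]
    ring
  have hmain := (hLpow.mul_const (g 0)).add hrem
  rw [one_mul, add_zero] at hmain
  refine hmain.congr' ?_
  filter_upwards [self_mem_nhdsWithin] with ε hε
  have hε : 0 < ε := hε
  have : ∫ t in (0:ℝ)..L, t ^ (ε - 1) * (g t - g 0) =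
      (∫ t in (0:ℝ)..L, t ^ (ε - 1) * g t) - (∫ t in (0:ℝ)..L, t ^ (ε - 1)) * g 0 := by
    simp only [mul_sub]
    rw [intervalIntegral.integral_sub ((hint ε hε).mul_continuousOn hgu)
      ((hint ε hε).mul_const _), intervalIntegral.integral_mul_const]
  rw [this, ← hval ε hε]
  ring

/-- The fractional integral `(1/Γ(n−α)) ∫_a^x (x−s)^{n−1−α} f(s) ds` tends to `f x`
as `α → n⁻` (with `α ∈ (n−1, n)`), for `f` continuous on `[a,b]` and `x ∈ (a,b]`. -/
theorem fractional_integral_tendsto_of_order_tendsto_nat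
    (n : ℕ) (hn : 0 < n) (a b : ℝ) (hab : a < b) (f : ℝ → ℝ)
    (hf : ContinuousOn f (Set.Icc a b)) (x : ℝ) (hx : x ∈ Set.Ioc a b) :
    Filter.Tendsto
      (fun α : ℝ => (1 / Real.Gamma ((n : ℝ) - α)) *
        ∫ s in a..x, (x - s) ^ ((n : ℝ) - 1 - α) * f s)
      (nhdsWithin (n : ℝ) (Set.Ioo ((n : ℝ) - 1) (n : ℝ)))
      (nhds (f x)) := by
  have h1 := approx_identity_aux (x - a) (sub_pos.2 hx.1) (fun t => f (x - t))
    (hf.comp (by fun_prop) (fun t ht => ⟨by linarith [ht.2], by linarith [ht.1, hx.2]⟩))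
  have hG : Filter.Tendsto (fun ε : ℝ => 1 / Real.Gamma (ε + 1)) (nhdsWithin 0 (Set.Ioi 0))
      (nhds 1) := by
    have hc : ContinuousAt Real.Gamma 1 :=
      (Real.differentiableAt_Gamma fun m h => by
        have : (0:ℝ) ≤ m := m.cast_nonneg
        linarith).continuousAt
    have h2 : Filter.Tendsto (fun ε : ℝ => ε + 1) (nhdsWithin 0 (Set.Ioi 0)) (nhds 1) := by
      have : Filter.Tendsto (fun ε : ℝ => ε + 1) (nhds 0) (nhds (0 + 1)) :=
        (continuous_add_const 1).tendsto 0
      rw [zero_add] at this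
      exact this.mono_left nhdsWithin_le_nhds
    have h3 := hc.tendsto.comp h2
    rw [Real.Gamma_one] at h3
    simpa using h3.inv₀ one_ne_zero
  have hsub : Filter.Tendsto (fun α : ℝ => (n : ℝ) - α)
      (nhdsWithin (n : ℝ) (Set.Ioo ((n : ℝ) - 1) (n : ℝ))) (nhdsWithin 0 (Set.Ioi 0)) := by
    refine tendsto_nhdsWithin_iff.2 ⟨?_, ?_⟩
    · have : Filter.Tendsto (fun α : ℝ => (n : ℝ) - α) (nhds (n : ℝ)) (nhds ((n : ℝ) - n)) :=
        (continuous_const.sub continuous_id).tendsto _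
      rw [sub_self] at this
      exact this.mono_left nhdsWithin_le_nhds
    · filter_upwards [self_mem_nhdsWithin] with α hα
      exact sub_pos.2 hα.2
  have h4 := (hG.mul h1).comp hsub
  simp only [one_mul, sub_zero] at h4
  refine h4.congr' ?_
  filter_upwards [self_mem_nhdsWithin] with α hα
  have hε : 0 < (n : ℝ) - α := sub_pos.2 hα.2
  have hsubst : ∫ s in a..x, (x - s) ^ ((n : ℝ) - 1 - α) * f s =
      ∫ t in (0:ℝ)..(x - a), t ^ ((n : ℝ) - α - 1) * f (x - t) := by
    have := intervalIntegral.integral_comp_sub_left (a := a) (b := x)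
      (fun t => t ^ ((n : ℝ) - α - 1) * f (x - t)) x
    simp only [sub_self, sub_sub_cancel] at this
    rw [← this, sub_right_comm]
  have hΓ := Real.Gamma_pos_of_pos hε
  simp only [Function.comp]
  rw [hsubst, Real.Gamma_add_one hε.ne']
  field_simp
end

section
/- Let a < b be real numbers, let u : ℝ → ℝ be continuously differentiable on [a,b], and let x ∈ (a,b]. Then the expression u(a)(x−a)^{−α}/Γ(1−α) + (1/Γ(1−α)) ∫_a^x (x−s)^{−α} u′(s) ds, which equals the left Riemann–Liouville fractional derivative of order α of u on [a,b] at x, tends to u′(x) as α tends to 1 from the left (α ∈ (0,1)). -/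
open Filter Topology in
theorem rl_aux (L : ℝ) (hL : 0 < L) (v : ℝ → ℝ) (hv : ContinuousOn v (Set.Icc 0 L)) :
    Tendsto (fun α : ℝ => (1 / Real.Gamma (1 - α)) * ∫ t in (0:ℝ)..L, t ^ (-α) * v t)
      (𝓝[Set.Ioo (0 : ℝ) 1] 1) (𝓝 (v 0)) ∧
    Tendsto (fun α : ℝ => 1 / Real.Gamma (1 - α)) (𝓝[Set.Ioo (0 : ℝ) 1] 1) (𝓝 0) := by
  have hmem : ∀ᶠ α : ℝ in 𝓝[Set.Ioo (0 : ℝ) 1] 1, α ∈ Set.Ioo (0:ℝ) 1 := self_mem_nhdsWithin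
  have hGam : ContinuousAt (fun α : ℝ => 1 / Real.Gamma (2 - α)) 1 := by
    have h1 : ContinuousAt Real.Gamma (2 - 1) := by
      apply (Real.differentiableAt_Gamma _).continuousAt
      intro m
      have : (0:ℝ) ≤ m := Nat.cast_nonneg m
      linarith
    have h2 : ContinuousAt (fun α : ℝ => Real.Gamma (2 - α)) 1 :=
      ContinuousAt.comp (f := fun α : ℝ => 2 - α) h1 (by fun_prop)
    refine continuousAt_const.div h2 ?_
    exact (Real.Gamma_pos_of_pos (by norm_num)).ne'
  have hval : 1 / Real.Gamma (2 - 1) = 1 := by norm_num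
  have hrec : ∀ α ∈ Set.Ioo (0:ℝ) 1,
      1 / Real.Gamma (1 - α) = (1 - α) * (1 / Real.Gamma (2 - α)) := by
    intro α hα
    have h0 : (1 - α) ≠ 0 := by linarith [hα.2]
    have := Real.Gamma_add_one h0
    rw [show (2 - α) = 1 - α + 1 by ring, this]
    have := (Real.Gamma_pos_of_pos (show 0 < 1 - α by linarith [hα.2])).ne'
    field_simp
  have hD : Tendsto (fun α : ℝ => 1 / Real.Gamma (1 - α)) (𝓝[Set.Ioo (0 : ℝ) 1] 1) (𝓝 0) := by
    have h : ContinuousAt (fun α : ℝ => (1 - α) * (1 / Real.Gamma (2 - α))) 1 :=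
      ContinuousAt.mul (by fun_prop) hGam
    have h' := h.tendsto.mono_left (nhdsWithin_le_nhds (s := Set.Ioo (0:ℝ) 1))
    simp only [sub_self, zero_mul] at h'
    refine h'.congr' ?_
    filter_upwards [hmem] with α hα using (hrec α hα).symm
  refine ⟨?_, hD⟩
  have hG : Tendsto (fun α : ℝ => 1 / Real.Gamma (1 - α) * (L ^ (1 - α) / (1 - α)))
      (𝓝[Set.Ioo (0 : ℝ) 1] 1) (𝓝 1) := by
    have hp : ContinuousAt (fun α : ℝ => L ^ (1 - α)) 1 :=
      ContinuousAt.rpow (by fun_prop) (by fun_prop) (Or.inl hL.ne')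
    have h' := (hGam.mul hp).tendsto.mono_left (nhdsWithin_le_nhds (s := Set.Ioo (0:ℝ) 1))
    simp only [Pi.mul_apply, hval, sub_self, Real.rpow_zero, mul_one] at h'
    refine h'.congr' ?_
    filter_upwards [hmem] with α hα
    simp only [Pi.mul_apply]
    have h0 : (1 - α) ≠ 0 := by linarith [hα.2]
    rw [hrec α hα]
    field_simp
  have hH : Tendsto (fun α : ℝ => L ^ (2 - α) / (2 - α))
      (𝓝[Set.Ioo (0 : ℝ) 1] 1) (𝓝 L) := by
    have hp : ContinuousAt (fun α : ℝ => L ^ (2 - α) / (2 - α)) 1 :=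
      (ContinuousAt.rpow (by fun_prop) (by fun_prop) (Or.inl hL.ne')).div (by fun_prop)
        (by norm_num)
    have h' := hp.tendsto.mono_left (nhdsWithin_le_nhds (s := Set.Ioo (0:ℝ) 1))
    have e : L ^ ((2:ℝ) - 1) / (2 - 1) = L := by norm_num
    rw [e] at h'
    exact h'
  have huIcc : Set.uIcc 0 L = Set.Icc 0 L := Set.uIcc_of_le hL.le
  have hi0 : ∀ α ∈ Set.Ioo (0:ℝ) 1,
      IntervalIntegrable (fun t : ℝ => t ^ (-α)) MeasureTheory.volume 0 L := fun α hα =>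
    intervalIntegral.intervalIntegrable_rpow' (by linarith [hα.2])
  have hI0 : ∀ α ∈ Set.Ioo (0:ℝ) 1, ∫ t in (0:ℝ)..L, t ^ (-α) = L ^ (1 - α) / (1 - α) := by
    intro α hα
    rw [integral_rpow (Or.inl (by linarith [hα.2])), Real.zero_rpow (by linarith [hα.2]),
      show -α + 1 = 1 - α by ring, sub_zero]
  have hI1 : ∀ α ∈ Set.Ioo (0:ℝ) 1, ∫ t in (0:ℝ)..L, t ^ (-α) * t = L ^ (2 - α) / (2 - α) := by
    intro α hα
    have : ∫ t in (0:ℝ)..L, t ^ (-α) * t = ∫ t in (0:ℝ)..L, t ^ (-α + 1) := by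
      apply intervalIntegral.integral_congr
      intro t ht
      rw [huIcc] at ht
      exact (Real.rpow_add_one' ht.1 (by linarith [hα.2])).symm
    rw [this, integral_rpow (Or.inl (by linarith [hα.2])), Real.zero_rpow (by linarith [hα.2]),
      show -α + 1 + 1 = 2 - α by ring, sub_zero]
  have hbound : ∀ ε > 0, ∃ C, ∀ t ∈ Set.Icc 0 L, |v t - v 0| ≤ ε + C * t := by
    intro ε hε
    obtain ⟨M, hM⟩ := isCompact_Icc.exists_bound_of_continuousOn 
      (f := fun t => v t - v 0) (hv.sub continuousOn_const)
    have h0 := hv 0 ⟨le_rfl, hL.le⟩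
    obtain ⟨δ, hδ, hd⟩ := Metric.continuousWithinAt_iff.1 h0 ε hε
    have hM0 : 0 ≤ M := (norm_nonneg _).trans (hM 0 ⟨le_rfl, hL.le⟩)
    refine ⟨M / δ, fun t ht => ?_⟩
    by_cases h : t < δ
    · have h1 := hd ht (by rw [Real.dist_eq, sub_zero, abs_of_nonneg ht.1]; exact h)
      rw [Real.dist_eq] at h1
      have : 0 ≤ M / δ * t := mul_nonneg (by positivity) ht.1
      linarith
    · have h1 : |v t - v 0| ≤ M := hM t ht
      have : M ≤ M / δ * t := by
        rw [div_mul_eq_mul_div, le_div_iff₀ hδ]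
        exact mul_le_mul_of_nonneg_left (not_lt.1 h) hM0
      linarith
  have hR : Tendsto (fun α : ℝ => (1 / Real.Gamma (1 - α)) *
      ∫ t in (0:ℝ)..L, t ^ (-α) * (v t - v 0)) (𝓝[Set.Ioo (0 : ℝ) 1] 1) (𝓝 0) := by
    rw [Metric.tendsto_nhds]
    intro ε hε
    obtain ⟨C, hC⟩ := hbound (ε / 2) (by linarith)
    have hlim := (hG.const_mul (ε / 2)).add ((hD.mul hH).const_mul C)
    have hev := hlim.eventually (gt_mem_nhds (show ε / 2 * 1 + C * (0 * L) < ε by linarith))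
    filter_upwards [hev, hmem] with α h1 hα
    rw [Real.dist_eq, sub_zero]
    refine lt_of_le_of_lt ?_ h1
    have hDp : 0 ≤ 1 / Real.Gamma (1 - α) :=
      (one_div_pos.2 (Real.Gamma_pos_of_pos (by linarith [hα.2]))).le
    have hint1 : IntervalIntegrable (fun t : ℝ => t ^ (-α) * t) MeasureTheory.volume 0 L :=
      (hi0 α hα).mul_continuousOn continuousOn_id
    have key : |∫ t in (0:ℝ)..L, t ^ (-α) * (v t - v 0)| ≤
        ε / 2 * (L ^ (1 - α) / (1 - α)) + C * (L ^ (2 - α) / (2 - α)) := by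
      rw [← hI0 α hα, ← hI1 α hα, ← intervalIntegral.integral_const_mul,
        ← intervalIntegral.integral_const_mul,
        ← intervalIntegral.integral_add ((hi0 α hα).const_mul _) (hint1.const_mul _),
        ← Real.norm_eq_abs]
      refine intervalIntegral.norm_integral_le_of_norm_le hL.le ?_
        (((hi0 α hα).const_mul _).add (hint1.const_mul _))
      refine Eventually.of_forall fun t ht => ?_
      have hp : 0 ≤ t ^ (-α) := Real.rpow_nonneg ht.1.le _
      rw [Real.norm_eq_abs, abs_mul, abs_of_nonneg hp]
      have := mul_le_mul_of_nonneg_left (hC t ⟨ht.1.le, ht.2⟩) hp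
      linarith
    rw [abs_mul, abs_of_nonneg hDp]
    have := mul_le_mul_of_nonneg_left key hDp
    linarith
  have hfin := (hG.mul_const (v 0)).add hR
  rw [one_mul, add_zero] at hfin
  refine hfin.congr' ?_
  filter_upwards [hmem] with α hα
  have hv' : ContinuousOn (fun t => v t - v 0) (Set.uIcc 0 L) := by
    rw [huIcc]; exact hv.sub continuousOn_const
  have : ∫ t in (0:ℝ)..L, t ^ (-α) * v t =
      (L ^ (1 - α) / (1 - α)) * v 0 + ∫ t in (0:ℝ)..L, t ^ (-α) * (v t - v 0) := by
    rw [← hI0 α hα, ← intervalIntegral.integral_mul_const,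
      ← intervalIntegral.integral_add ((hi0 α hα).mul_const _) ((hi0 α hα).mul_continuousOn hv')]
    congr 1
    ext t
    ring
  rw [this]
  ring

/-- Consistency: the left Riemann–Liouville fractional derivative of order `α`
(of a continuously differentiable `u`) tends to `u′(x)` as `α → 1⁻`. -/
theorem left_riemannLiouville_tendsto_deriv_of_order_tendsto_one
    (a b : ℝ) (hab : a < b)
    (u u' : ℝ → ℝ)
    (hu : ∀ y ∈ Set.Icc a b, HasDerivAt u (u' y) y)
    (hu' : ContinuousOn u' (Set.Icc a b))
    (x : ℝ) (hx : x ∈ Set.Ioc a b) :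
    Filter.Tendsto
      (fun α : ℝ => u a * (x - a) ^ (-α) / Real.Gamma (1 - α) +
        (1 / Real.Gamma (1 - α)) * ∫ s in a..x, (x - s) ^ (-α) * u' s)
      (nhdsWithin (1 : ℝ) (Set.Ioo (0 : ℝ) 1))
      (nhds (u' x)) := by
  have hL : 0 < x - a := by linarith [hx.1]
  have hv : ContinuousOn (fun t => u' (x - t)) (Set.Icc 0 (x - a)) := by
    refine hu'.comp (by fun_prop) ?_
    intro t ht
    exact ⟨by linarith [ht.2], by linarith [ht.1, hx.2]⟩
  obtain ⟨h1, h2⟩ := rl_aux (x - a) hL _ hv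
  have hp : ContinuousAt (fun α : ℝ => u a * (x - a) ^ (-α)) 1 :=
    continuousAt_const.mul (ContinuousAt.rpow (by fun_prop) (by fun_prop) (Or.inl hL.ne'))
  have hp' := hp.tendsto.mono_left (nhdsWithin_le_nhds (s := Set.Ioo (0:ℝ) 1))
  have h := (hp'.mul h2).add h1
  simp only [mul_zero, zero_add, sub_zero] at h
  refine h.congr fun α => ?_
  have e := intervalIntegral.integral_comp_sub_left (a := a) (b := x)
    (fun t => t ^ (-α) * u' (x - t)) x
  simp only [sub_sub_cancel, sub_self] at e
  rw [e]
  ring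
end

section
/- Let a < b be real numbers, let u : ℝ → ℝ be continuously differentiable on [a,b], and let x ∈ [a,b). Then the expression u(b)(b−x)^{−α}/Γ(1−α) − (1/Γ(1−α)) ∫_x^b (s−x)^{−α} u′(s) ds, which equals the right Riemann–Liouville fractional derivative of order α of u on [a,b] at x, tends to −u′(x) as α tends to 1 from the left (α ∈ (0,1)). -/
/-- Consistency: the right Riemann–Liouville fractional derivative of order `α`
(of a continuously differentiable `u`) tends to `−u′(x)` as `α → 1⁻`. -/
theorem right_riemannLiouville_tendsto_neg_deriv_of_order_tendsto_one
    (a b : ℝ) (hab : a < b)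
    (u u' : ℝ → ℝ)
    (hu : ∀ y ∈ Set.Icc a b, HasDerivAt u (u' y) y)
    (hu' : ContinuousOn u' (Set.Icc a b))
    (x : ℝ) (hx : x ∈ Set.Ico a b) :
    Filter.Tendsto
      (fun α : ℝ => u b * (b - x) ^ (-α) / Real.Gamma (1 - α) -
        (1 / Real.Gamma (1 - α)) * ∫ s in x..b, (s - x) ^ (-α) * u' s)
      (nhdsWithin (1 : ℝ) (Set.Ioo (0 : ℝ) 1))
      (nhds (-u' x)) := by
  obtain ⟨hax, hxb⟩ := hx
  have hL : 0 < b - x := sub_pos.2 hxb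
  have hcont : ContinuousOn u' (Set.Icc x b) := hu'.mono (Set.Icc_subset_Icc_left hax)
  -- pointwise bound
  have hbound : ∀ ε : ℝ, 0 < ε → ∃ K : ℝ, 0 ≤ K ∧ ∀ s ∈ Set.Icc x b,
      |u' s - u' x| ≤ ε + K * (s - x) := by
    intro ε hε
    obtain ⟨M, hM⟩ := isCompact_Icc.exists_bound_of_continuousOn
      (hcont.sub (continuousOn_const (c := u' x)))
    have h1 := Metric.continuousOn_iff.1 hcont x ⟨le_rfl, hxb.le⟩ ε hε
    obtain ⟨δ, hδ, h1⟩ := h1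
    have hM0 : 0 ≤ M := (norm_nonneg _).trans (hM x ⟨le_rfl, hxb.le⟩)
    refine ⟨M / δ, by positivity, fun s hs => ?_⟩
    have hs0 : 0 ≤ s - x := sub_nonneg.2 hs.1
    rcases lt_or_ge (s - x) δ with h | h
    · have := h1 s hs (by rw [Real.dist_eq, abs_of_nonneg hs0]; exact h)
      rw [Real.dist_eq] at this
      have : 0 ≤ M / δ * (s - x) := by positivity
      linarith
    · have h2 := hM s hs
      rw [Real.norm_eq_abs] at h2
      have : M ≤ M / δ * (s - x) := by
        rw [div_mul_eq_mul_div, le_div_iff₀ hδ]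
        exact mul_le_mul_of_nonneg_left h hM0
      simp only [Pi.sub_apply] at h2
      linarith
  have hpowint : ∀ r : ℝ, -1 < r →
      IntervalIntegrable (fun s : ℝ => (s - x) ^ r) MeasureTheory.volume x b := by
    intro r hr
    have := (intervalIntegral.intervalIntegrable_rpow' (a := 0) (b := b - x) hr).comp_sub_right x
    simpa using this
  have hpowval : ∀ r : ℝ, -1 < r →
      ∫ s in x..b, (s - x) ^ r = (b - x) ^ (r + 1) / (r + 1) := by
    intro r hr
    rw [intervalIntegral.integral_comp_sub_right (fun s : ℝ => s ^ r) x,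
      integral_rpow (Or.inl hr), sub_self, Real.zero_rpow (by linarith), sub_zero]
  have hGam : ∀ α ∈ Set.Ioo (0 : ℝ) 1,
      1 / Real.Gamma (1 - α) = (1 - α) / Real.Gamma (2 - α) := by
    intro α hα
    have h0 : (1 - α) ≠ 0 := by linarith [hα.2]
    have : Real.Gamma (2 - α) = (1 - α) * Real.Gamma (1 - α) := by
      rw [← Real.Gamma_add_one h0]; congr 1; ring
    have h2 : Real.Gamma (1 - α) ≠ 0 := (Real.Gamma_pos_of_pos (by linarith [hα.2])).ne'
    rw [this]; field_simp
  have hGc : ContinuousAt (fun α : ℝ => Real.Gamma (2 - α)) 1 := by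
    have : ContinuousAt Real.Gamma (2 - 1) := by
      refine (Real.differentiableAt_Gamma ?_).continuousAt
      intro m
      have : (0 : ℝ) ≤ m := Nat.cast_nonneg m
      linarith
    exact ContinuousAt.comp (f := fun α : ℝ => 2 - α) this (by fun_prop)
  have hG1 : Real.Gamma (2 - 1) ≠ 0 := by
    norm_num
  have hpc : ∀ c : ℝ, ContinuousAt (fun α : ℝ => (b - x) ^ (c - α)) 1 := fun c =>
    ContinuousAt.rpow continuousAt_const (by fun_prop) (Or.inl hL.ne')
  set l := nhdsWithin (1 : ℝ) (Set.Ioo (0 : ℝ) 1) with hl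
  have hlim1 : Filter.Tendsto (fun α : ℝ => (b - x) ^ (1 - α) / Real.Gamma (2 - α)) l (nhds 1) := by
    have h := ((hpc 1).div hGc hG1).tendsto.mono_left (nhdsWithin_le_nhds (s := Set.Ioo (0:ℝ) 1))
    have e : (2 : ℝ) - 1 = 1 := by norm_num
    convert h using 2
    · rfl
    · simp [e]
  have hlim0 : ∀ c : ℝ, Filter.Tendsto
      (fun α : ℝ => (b - x) ^ (c - α) * ((1 - α) / Real.Gamma (2 - α))) l (nhds 0) := by
    intro c
    have h1 : ContinuousAt (fun α : ℝ => 1 - α) 1 := by fun_prop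
    have h := ((hpc c).mul (h1.div hGc hG1)).tendsto.mono_left
      (nhdsWithin_le_nhds (s := Set.Ioo (0:ℝ) 1))
    convert h using 2
    · rfl
    · simp
  have hlim2 : Filter.Tendsto (fun α : ℝ => (b - x) ^ (2 - α) * ((1 - α) / Real.Gamma (2 - α))
      / (2 - α)) l (nhds 0) := by
    have h1 : ContinuousAt (fun α : ℝ => 2 - α) 1 := by fun_prop
    have h := (hlim0 2).div (h1.tendsto.mono_left (nhdsWithin_le_nhds (s := Set.Ioo (0:ℝ) 1)))
      (by norm_num)
    convert h using 2
    · rfl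
    · simp
  have hdint : ∀ α ∈ Set.Ioo (0 : ℝ) 1, IntervalIntegrable
      (fun s : ℝ => (s - x) ^ (-α) * (u' s - u' x)) MeasureTheory.volume x b := by
    intro α hα
    refine (hpowint (-α) (by linarith [hα.2])).mul_continuousOn ?_
    rw [Set.uIcc_of_le hxb.le]
    exact hcont.sub continuousOn_const
  have hD : Filter.Tendsto (fun α : ℝ => (1 - α) / Real.Gamma (2 - α) *
      ∫ s in x..b, (s - x) ^ (-α) * (u' s - u' x)) l (nhds 0) := by
    rw [Metric.tendsto_nhds]
    intro ε hε
    obtain ⟨K, hK, hb⟩ := hbound (ε / 2) (by positivity)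
    have hlim := (hlim1.const_mul (ε / 2)).add (hlim2.const_mul K)
    have hev := hlim.eventually (gt_mem_nhds (show ε / 2 * 1 + K * 0 < ε by linarith))
    filter_upwards [hev, self_mem_nhdsWithin] with α h1 hα
    have hα1 : 0 < 1 - α := by linarith [hα.2]
    have hGp : 0 < Real.Gamma (2 - α) := Real.Gamma_pos_of_pos (by linarith)
    have hc : 0 < (1 - α) / Real.Gamma (2 - α) := by positivity
    have i1 := hpowint (-α) (by linarith)
    have i2 := hpowint (1 - α) (by linarith)
    have key : |∫ s in x..b, (s - x) ^ (-α) * (u' s - u' x)| ≤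
        ∫ s in x..b, (ε / 2 * (s - x) ^ (-α) + K * (s - x) ^ (1 - α)) := by
      rw [← Real.norm_eq_abs]
      refine intervalIntegral.norm_integral_le_of_norm_le hxb.le ?_
        ((i1.const_mul _).add (i2.const_mul _))
      refine Filter.Eventually.of_forall fun s hs => ?_
      have hs0 : 0 < s - x := sub_pos.2 hs.1
      have hp : 0 < (s - x) ^ (-α) := Real.rpow_pos_of_pos hs0 _
      have he : (s - x) ^ (1 - α) = (s - x) ^ (-α) * (s - x) := by
        rw [← Real.rpow_add_one hs0.ne']; congr 1; ring
      rw [norm_mul, Real.norm_eq_abs, Real.norm_eq_abs, abs_of_pos hp, he]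
      have := mul_le_mul_of_nonneg_left (hb s ⟨hs.1.le, hs.2⟩) hp.le
      linarith
    rw [intervalIntegral.integral_add (i1.const_mul _) (i2.const_mul _),
      intervalIntegral.integral_const_mul, intervalIntegral.integral_const_mul,
      hpowval _ (by linarith), hpowval _ (by linarith),
      show -α + 1 = 1 - α by ring, show 1 - α + 1 = 2 - α by ring] at key
    rw [Real.dist_eq, sub_zero, abs_mul, abs_of_pos hc]
    refine lt_of_le_of_lt (mul_le_mul_of_nonneg_left key hc.le) (lt_of_eq_of_lt ?_ h1)
    have : 2 - α ≠ 0 := by linarith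
    field_simp
  have hfin := ((hlim0 0).const_mul (u b)).sub ((hlim1.const_mul (u' x)).add hD)
  have e : u b * 0 - (u' x * 1 + 0) = -u' x := by ring
  rw [e] at hfin
  refine hfin.congr' ?_
  filter_upwards [self_mem_nhdsWithin] with α hα
  have hα1 : 0 < 1 - α := by linarith [hα.2]
  have i1 := hpowint (-α) (by linarith)
  have hsplit : ∫ s in x..b, (s - x) ^ (-α) * u' s =
      (∫ s in x..b, (s - x) ^ (-α) * (u' s - u' x)) + u' x * ((b - x) ^ (1 - α) / (1 - α)) := by
    rw [show 1 - α = -α + 1 by ring, ← hpowval _ (by linarith),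
      ← intervalIntegral.integral_const_mul,
      ← intervalIntegral.integral_add (hdint α hα) (i1.const_mul _)]
    congr 1; ext s; ring
  rw [hsplit, div_eq_mul_one_div (u b * _), hGam α hα, zero_sub]
  have hGp : Real.Gamma (2 - α) ≠ 0 := (Real.Gamma_pos_of_pos (by linarith)).ne'
  field_simp
  ring
end

section
/- Let a < b be real numbers, let u : ℝ → ℝ be twice continuously differentiable on [a,b], and let x ∈ (a,b]. Then the expression u(a)(x−a)^{−α}/Γ(1−α) + u′(a)(x−a)^{1−α}/Γ(2−α) + (1/Γ(2−α)) ∫_a^x (x−s)^{1−α} u″(s) ds, which equals the left Riemann–Liouville fractional derivative of order α of u on [a,b] at x, tends to u′(x) as α tends to 1 from the right (α ∈ (1,2)). -/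
/-- Consistency: the left Riemann–Liouville fractional derivative of order `α ∈ (1,2)`
(of a twice continuously differentiable `u`) tends to `u′(x)` as `α → 1⁺`. -/
theorem left_riemannLiouville_tendsto_deriv_of_order_tendsto_one_right
    (a b : ℝ) (hab : a < b)
    (u u' u'' : ℝ → ℝ)
    (hu : ∀ y ∈ Set.Icc a b, HasDerivAt u (u' y) y)
    (hu' : ∀ y ∈ Set.Icc a b, HasDerivAt u' (u'' y) y)
    (hu'' : ContinuousOn u'' (Set.Icc a b))
    (x : ℝ) (hx : x ∈ Set.Ioc a b) :
    Filter.Tendsto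
      (fun α : ℝ => u a * (x - a) ^ (-α) / Real.Gamma (1 - α) +
        u' a * (x - a) ^ (1 - α) / Real.Gamma (2 - α) +
        (1 / Real.Gamma (2 - α)) * ∫ s in a..x, (x - s) ^ (1 - α) * u'' s)
      (nhdsWithin (1 : ℝ) (Set.Ioo (1 : ℝ) 2))
      (nhds (u' x)) := by
  obtain ⟨hax, hxb⟩ := hx
  have hpos : 0 < x - a := sub_pos.2 hax
  have hsub : Set.Icc a x ⊆ Set.Icc a b := Set.Icc_subset_Icc_right hxb
  have hc : ContinuousOn u'' (Set.Icc a x) := hu''.mono hsub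
  have hid : Filter.Tendsto (fun α : ℝ => α) (nhdsWithin (1 : ℝ) (Set.Ioo (1 : ℝ) 2)) (nhds 1) :=
    Filter.tendsto_id.mono_left nhdsWithin_le_nhds
  have hmem : ∀ᶠ α in nhdsWithin (1 : ℝ) (Set.Ioo (1 : ℝ) 2), α ∈ Set.Ioo (1 : ℝ) 2 :=
    self_mem_nhdsWithin
  have h32 : ∀ᶠ α in nhdsWithin (1 : ℝ) (Set.Ioo (1 : ℝ) 2), α < 3 / 2 :=
    hid.eventually (gt_mem_nhds (by norm_num))
  have hsub1 : Filter.Tendsto (fun α : ℝ => 1 - α)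
      (nhdsWithin (1 : ℝ) (Set.Ioo (1 : ℝ) 2)) (nhds 0) := by
    simpa using hid.const_sub 1
  have hG : Filter.Tendsto (fun α : ℝ => Real.Gamma (2 - α))
      (nhdsWithin (1 : ℝ) (Set.Ioo (1 : ℝ) 2)) (nhds 1) := by
    have h1 : ContinuousAt Real.Gamma 1 := by
      apply DifferentiableAt.continuousAt (𝕜 := ℝ)
      apply Real.differentiableAt_Gamma
      intro m h
      have : (0 : ℝ) ≤ m := Nat.cast_nonneg m
      linarith
    have h2 : Filter.Tendsto (fun α : ℝ => 2 - α)
        (nhdsWithin (1 : ℝ) (Set.Ioo (1 : ℝ) 2)) (nhds 1) := by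
      have := hid.const_sub 2
      rwa [show (2 : ℝ) - 1 = 1 by norm_num] at this
    have h3 := h1.tendsto.comp h2
    rw [Real.Gamma_one] at h3
    exact h3
  have hpow : ∀ t : ℝ, 0 < t → Filter.Tendsto (fun α : ℝ => t ^ (1 - α))
      (nhdsWithin (1 : ℝ) (Set.Ioo (1 : ℝ) 2)) (nhds 1) := by
    intro t ht
    have := (Real.continuousAt_const_rpow (b := (0 : ℝ)) ht.ne').tendsto.comp hsub1
    simpa [Function.comp_def] using this
  have hT1 : Filter.Tendsto (fun α : ℝ => u a * (x - a) ^ (-α) / Real.Gamma (1 - α))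
      (nhdsWithin (1 : ℝ) (Set.Ioo (1 : ℝ) 2)) (nhds 0) := by
    have hp : Filter.Tendsto (fun α : ℝ => (x - a) ^ (-α))
        (nhdsWithin (1 : ℝ) (Set.Ioo (1 : ℝ) 2)) (nhds ((x - a) ^ (-1 : ℝ))) :=
      (Real.continuousAt_const_rpow (b := (-1 : ℝ)) hpos.ne').tendsto.comp hid.neg
    have h := ((hp.const_mul (u a)).mul hsub1).div hG one_ne_zero
    have hz : u a * (x - a) ^ (-1 : ℝ) * 0 / 1 = 0 := by ring
    rw [hz] at h
    refine h.congr' ?_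
    filter_upwards [hmem] with α hα
    have hne : (1 : ℝ) - α ≠ 0 := by have := hα.1; intro h; linarith
    have hg := Real.Gamma_add_one hne
    have h2 : (1 : ℝ) - α + 1 = 2 - α := by ring
    rw [h2] at hg
    simp only [Pi.div_apply]
    rw [hg, mul_comm (1 - α), mul_div_mul_right _ _ hne]
  have hT2 : Filter.Tendsto (fun α : ℝ => u' a * (x - a) ^ (1 - α) / Real.Gamma (2 - α))
      (nhdsWithin (1 : ℝ) (Set.Ioo (1 : ℝ) 2)) (nhds (u' a)) := by
    have h := ((hpow _ hpos).const_mul (u' a)).div hG one_ne_zero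
    rw [mul_one, div_one] at h
    exact h
  obtain ⟨C, hC⟩ := isCompact_Icc.exists_bound_of_continuousOn hc
  have hInt : Filter.Tendsto (fun α : ℝ => ∫ s in a..x, (x - s) ^ (1 - α) * u'' s)
      (nhdsWithin (1 : ℝ) (Set.Ioo (1 : ℝ) 2)) (nhds (∫ s in a..x, u'' s)) := by
    have hne : ∀ᵐ s : ℝ, s ≠ x := by
      simp [MeasureTheory.ae_iff]
    apply intervalIntegral.tendsto_integral_filter_of_dominated_convergence
      (fun s => (1 + (x - s) ^ (-(1 / 2) : ℝ)) * C)
    · refine Filter.Eventually.of_forall fun α => ?_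
      apply MeasureTheory.AEStronglyMeasurable.mul
      · exact (Measurable.pow_const (measurable_const.sub measurable_id) _).aestronglyMeasurable
      · rw [Set.uIoc_of_le hax.le]
        exact (hc.mono Set.Ioc_subset_Icc_self).aestronglyMeasurable measurableSet_Ioc
    · filter_upwards [hmem, h32] with α hα hα2
      filter_upwards [hne] with s hs hs2
      rw [Set.uIoc_of_le hax.le] at hs2
      have ht : 0 < x - s := sub_pos.2 (lt_of_le_of_ne hs2.2 hs)
      have hα1 := hα.1
      rw [norm_mul, Real.norm_of_nonneg (Real.rpow_nonneg ht.le _)]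
      have h0 : 0 ≤ (x - s) ^ (-(1 / 2) : ℝ) := Real.rpow_nonneg ht.le _
      apply mul_le_mul _ (hC s ⟨hs2.1.le, hs2.2⟩) (norm_nonneg _) (by linarith)
      rcases le_total 1 (x - s) with h1 | h1
      · have := Real.rpow_le_one_of_one_le_of_nonpos h1 (by linarith : 1 - α ≤ 0)
        linarith
      · have := Real.rpow_le_rpow_of_exponent_ge ht h1 (by linarith : -(1 / 2) ≤ 1 - α)
        linarith
    · apply IntervalIntegrable.mul_const
      apply IntervalIntegrable.add intervalIntegrable_const
      have h := (intervalIntegral.intervalIntegrable_rpow' (a := x - a) (b := 0)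
        (r := (-(1 / 2) : ℝ)) (by norm_num)).comp_sub_left x
      simpa using h
    · filter_upwards [hne] with s hs hs2
      rw [Set.uIoc_of_le hax.le] at hs2
      have ht : 0 < x - s := sub_pos.2 (lt_of_le_of_ne hs2.2 hs)
      simpa using (hpow _ ht).mul_const (u'' s)
  have hFTC : ∫ s in a..x, u'' s = u' x - u' a := by
    apply intervalIntegral.integral_eq_sub_of_hasDerivAt
    · intro s hs
      rw [Set.uIcc_of_le hax.le] at hs
      exact hu' s (hsub hs)
    · apply ContinuousOn.intervalIntegrable
      rwa [Set.uIcc_of_le hax.le]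
  rw [hFTC] at hInt
  have hfin := (hT1.add hT2).add (((tendsto_const_nhds (x := (1 : ℝ))).div hG one_ne_zero).mul hInt)
  have he : 0 + u' a + 1 / 1 * (u' x - u' a) = u' x := by ring
  rw [he] at hfin
  exact hfin
end

section
/- Let a < b be real numbers, let u : ℝ → ℝ be twice continuously differentiable on [a,b], and let x ∈ (a,b]. Then the expression u(a)(x−a)^{−α}/Γ(1−α) + u′(a)(x−a)^{1−α}/Γ(2−α) + (1/Γ(2−α)) ∫_a^x (x−s)^{1−α} u″(s) ds, which equals the left Riemann–Liouville fractional derivative of order α of u on [a,b] at x, tends to u″(x) as α tends to 2 from the left (α ∈ (1,2)). -/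
/-- Consistency: the left Riemann–Liouville fractional derivative of order `α ∈ (1,2)`
(of a twice continuously differentiable `u`) tends to `u″(x)` as `α → 2⁻`. -/
theorem left_riemannLiouville_tendsto_second_deriv_of_order_tendsto_two
    (a b : ℝ) (hab : a < b)
    (u u' u'' : ℝ → ℝ)
    (hu : ∀ y ∈ Set.Icc a b, HasDerivAt u (u' y) y)
    (hu' : ∀ y ∈ Set.Icc a b, HasDerivAt u' (u'' y) y)
    (hu'' : ContinuousOn u'' (Set.Icc a b))
    (x : ℝ) (hx : x ∈ Set.Ioc a b) :
    Filter.Tendsto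
      (fun α : ℝ => u a * (x - a) ^ (-α) / Real.Gamma (1 - α) +
        u' a * (x - a) ^ (1 - α) / Real.Gamma (2 - α) +
        (1 / Real.Gamma (2 - α)) * ∫ s in a..x, (x - s) ^ (1 - α) * u'' s)
      (nhdsWithin (2 : ℝ) (Set.Ioo (1 : ℝ) 2))
      (nhds (u'' x)) := by
  obtain ⟨hax, hxb⟩ := hx
  have hL : 0 < x - a := sub_pos.2 hax
  set l := nhdsWithin (2 : ℝ) (Set.Ioo (1 : ℝ) 2) with hl
  have hmem : ∀ᶠ α in l, α ∈ Set.Ioo (1 : ℝ) 2 := self_mem_nhdsWithin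
  have hid : Filter.Tendsto (fun α : ℝ => α) l (nhds 2) :=
    Filter.tendsto_id.mono_left nhdsWithin_le_nhds
  -- Γ(3 - α) → 1
  have hG3 : Filter.Tendsto (fun α : ℝ => Real.Gamma (3 - α)) l (nhds 1) := by
    have h1 : ContinuousAt Real.Gamma 1 :=
      (Real.differentiableAt_Gamma (fun m => by
        have : (0 : ℝ) ≤ m := m.cast_nonneg
        linarith)).continuousAt
    have h2 : Filter.Tendsto (fun α : ℝ => 3 - α) l (nhds 1) := by
      have := hid.const_sub 3
      norm_num at this
      exact this
    have h3 := h1.tendsto.comp h2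
    rw [Real.Gamma_one] at h3
    exact h3
  have hrec : ∀ᶠ α in l, 1 / Real.Gamma (2 - α) = (2 - α) / Real.Gamma (3 - α) := by
    filter_upwards [hmem] with α hα
    have h0 : 0 < 2 - α := by linarith [hα.2]
    have hG := Real.Gamma_pos_of_pos h0
    have : Real.Gamma (3 - α) = (2 - α) * Real.Gamma (2 - α) := by
      rw [← Real.Gamma_add_one h0.ne']
      congr 1
      ring
    rw [this]
    field_simp
  have hinv : Filter.Tendsto (fun α : ℝ => 1 / Real.Gamma (2 - α)) l (nhds 0) := by
    have h := (hid.const_sub 2).div hG3 one_ne_zero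
    rw [sub_self, zero_div] at h
    exact h.congr' (hrec.mono fun α h => h.symm)
  have hpow : ∀ δ : ℝ, 0 < δ →
      Filter.Tendsto (fun α : ℝ => δ ^ (1 - α)) l (nhds (δ ^ (1 - 2 : ℝ))) := by
    intro δ hδ
    exact tendsto_const_nhds.rpow (hid.const_sub 1) (Or.inl hδ.ne')
  have hT2 : Filter.Tendsto (fun α : ℝ => u' a * (x - a) ^ (1 - α) / Real.Gamma (2 - α)) l
      (nhds 0) := by
    have h := ((hpow _ hL).const_mul (u' a)).mul hinv
    rw [mul_zero] at h
    refine h.congr fun α => ?_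
    ring
  have hT1 : Filter.Tendsto (fun α : ℝ => u a * (x - a) ^ (-α) / Real.Gamma (1 - α)) l
      (nhds 0) := by
    have hp : Filter.Tendsto (fun α : ℝ => (x - a) ^ (-α)) l (nhds ((x - a) ^ (-2 : ℝ))) :=
      tendsto_const_nhds.rpow hid.neg (Or.inl hL.ne')
    have h := ((hp.const_mul (u a)).mul (hid.const_sub 1)).mul hinv
    rw [mul_zero] at h
    refine h.congr' ?_
    filter_upwards [hmem] with α hα
    have h1 : 1 - α ≠ 0 := by linarith [hα.1]
    have : Real.Gamma (2 - α) = (1 - α) * Real.Gamma (1 - α) := by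
      rw [← Real.Gamma_add_one h1]
      congr 1
      ring
    rw [this, one_div, mul_inv, div_eq_mul_inv]
    field_simp
  have hT3 : Filter.Tendsto (fun α : ℝ => ∫ s in Set.Ioc a x,
      (1 / Real.Gamma (2 - α) * (x - s) ^ (1 - α)) • u'' s) l (nhds (u'' x)) := by
    have hsub : Set.Ioc a x ⊆ Set.Icc a b := fun y hy => ⟨hy.1.le, hy.2.trans hxb⟩
    refine tendsto_setIntegral_peak_smul_of_integrableOn_of_tendsto (x₀ := x)
      measurableSet_Ioc measurableSet_Ioc subset_rfl self_mem_nhdsWithin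
      (by simp) ?_ ?_ ?_ ?_ ?_ ?_
    · filter_upwards [hmem] with α hα y hy
      have hG := Real.Gamma_pos_of_pos (show 0 < 2 - α by linarith [hα.2])
      have : 0 ≤ x - y := sub_nonneg.2 hy.2
      positivity
    · intro v hv hxv
      obtain ⟨δ, hδ, hball⟩ := Metric.isOpen_iff.1 hv x hxv
      rw [Metric.tendstoUniformlyOn_iff]
      intro ε hε
      have h := hinv.mul (hpow δ hδ)
      rw [zero_mul] at h
      filter_upwards [hmem, (tendsto_order.1 h).2 ε hε] with α hα hlt y hy
      have hG := Real.Gamma_pos_of_pos (show 0 < 2 - α by linarith [hα.2])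
      have h0 : 0 ≤ x - y := sub_nonneg.2 hy.1.2
      have hge : δ ≤ x - y := by
        by_contra hcon
        apply hy.2
        apply hball
        rw [Metric.mem_ball, dist_comm, Real.dist_eq, abs_of_nonneg h0]
        linarith
      have hle : (x - y) ^ (1 - α) ≤ δ ^ (1 - α) :=
        Real.rpow_le_rpow_of_nonpos hδ hge (by linarith [hα.1])
      rw [Pi.zero_apply, dist_zero_left, Real.norm_of_nonneg (by positivity)]
      refine lt_of_le_of_lt ?_ hlt
      gcongr
    · have hp : Filter.Tendsto (fun α : ℝ => (x - a) ^ (2 - α)) l (nhds 1) := by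
        have h := (tendsto_const_nhds (x := x - a)).rpow (hid.const_sub 2) (Or.inl hL.ne')
        rw [sub_self, Real.rpow_zero] at h
        exact h
      have h := hp.div hG3 one_ne_zero
      rw [div_one] at h
      refine h.congr' ?_
      filter_upwards [hmem, hrec] with α hα hr
      have h0 : 0 < 2 - α := by linarith [hα.2]
      rw [MeasureTheory.integral_const_mul, ← intervalIntegral.integral_of_le hax.le,
        intervalIntegral.integral_comp_sub_left (fun t => t ^ (1 - α)) x, sub_self,
        integral_rpow (Or.inl (by linarith)), hr]
      have h12 : 1 - α + 1 = 2 - α := by ring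
      rw [h12, Real.zero_rpow h0.ne', sub_zero, Pi.div_apply]
      field_simp
    · refine Filter.Eventually.of_forall fun α => ?_
      exact (by fun_prop : Measurable fun s : ℝ =>
        1 / Real.Gamma (2 - α) * (x - s) ^ (1 - α)).aestronglyMeasurable
    · exact (hu''.integrableOn_Icc).mono_set hsub
    · exact (hu'' x ⟨hax.le, hxb⟩).tendsto.mono_left (nhdsWithin_mono _ hsub)
  have h := (hT1.add hT2).add hT3
  rw [zero_add, zero_add] at h
  refine h.congr fun α => ?_
  rw [intervalIntegral.integral_of_le hax.le, ← MeasureTheory.integral_const_mul]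
  simp only [smul_eq_mul, mul_assoc]
end

section
/- Let α ∈ (0,1), let a, b > −1 be real parameters, and let x ∈ [−1,1). Then the right Riemann–Liouville fractional derivative of order α on [−1,1] of the polynomial p₁(s) = ((a+b+2)s + (a−b))/2 at x equals −((a+b+2)/2)·(1−x)^{1−α}/Γ(2−α) + (a+1)·(1−x)^{−α}/Γ(1−α); that is, the function y ↦ −(1/Γ(1−α)) ∫_y^1 (s−y)^{−α} p₁(s) ds is differentiable at x with this derivative. -/
theorem aux_rl_integral (α c a y : ℝ) (hα : α ∈ Set.Ioo (0 : ℝ) 1) (hy : y < 1) :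
    ∫ s in y..(1 : ℝ), (s - y) ^ (-α) * (c * s + (a + 1 - c)) =
      -c * (1 - y) ^ (2 - α) / ((2 - α) * (1 - α)) + (a + 1) * (1 - y) ^ (1 - α) / (1 - α) := by
  obtain ⟨h0, h1⟩ := hα
  have hL : 0 < 1 - y := by linarith
  have e1 : ∫ s in y..(1 : ℝ), (s - y) ^ (-α) * (c * s + (a + 1 - c)) =
      ∫ t in (0 : ℝ)..(1 - y), t ^ (-α) * (c * (t + y) + (a + 1 - c)) := by
    have := intervalIntegral.integral_comp_sub_right (a := y) (b := 1)
      (fun t : ℝ => t ^ (-α) * (c * (t + y) + (a + 1 - c))) y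
    simpa using this
  have e2 : ∫ t in (0 : ℝ)..(1 - y), t ^ (-α) * (c * (t + y) + (a + 1 - c)) =
      ∫ t in (0 : ℝ)..(1 - y), (c * t ^ (1 - α) + (a + 1 - c * (1 - y)) * t ^ (-α)) := by
    apply intervalIntegral.integral_congr_ae
    refine Filter.Eventually.of_forall fun t ht => ?_
    rw [Set.uIoc_of_le hL.le] at ht
    have : t ^ (1 - α) = t * t ^ (-α) := by
      rw [sub_eq_add_neg, Real.rpow_add ht.1, Real.rpow_one]
    rw [this]; ring
  have hp : (1 - y) ^ (2 - α) = (1 - y) * (1 - y) ^ (1 - α) := by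
    rw [show 2 - α = 1 + (1 - α) by ring, Real.rpow_add hL, Real.rpow_one]
  rw [e1, e2, intervalIntegral.integral_add
    ((intervalIntegral.intervalIntegrable_rpow' (by linarith)).const_mul _)
    ((intervalIntegral.intervalIntegrable_rpow' (by linarith)).const_mul _),
    intervalIntegral.integral_const_mul, intervalIntegral.integral_const_mul,
    integral_rpow (Or.inl (by linarith)), integral_rpow (Or.inl (by linarith)),
    show 1 - α + 1 = 2 - α by ring, show -α + 1 = 1 - α by ring,
    Real.zero_rpow (by linarith), Real.zero_rpow (by linarith), hp]
  have : 2 - α ≠ 0 := by linarith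
  have : 1 - α ≠ 0 := by linarith
  field_simp
  ring



/-- The right Riemann–Liouville fractional derivative of order `α ∈ (0,1)` of the
degree-one Jacobi polynomial `p₁(s) = ((a+b+2)s + (a−b))/2` on `[−1,1]` at
`x ∈ [−1,1)` equals `−((a+b+2)/2)(1−x)^{1−α}/Γ(2−α) + (a+1)(1−x)^{−α}/Γ(1−α)`. -/
theorem right_riemannLiouville_jacobiOne_eq
    (α : ℝ) (hα : α ∈ Set.Ioo (0 : ℝ) 1) (a b : ℝ) (ha : -1 < a) (hb : -1 < b)
    (x : ℝ) (hx : x ∈ Set.Ico (-1 : ℝ) 1) :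
    HasDerivAt
      (fun y => -((1 / Real.Gamma (1 - α)) *
        ∫ s in y..(1 : ℝ), (s - y) ^ (-α) * (((a + b + 2) * s + (a - b)) / 2)))
      (-((a + b + 2) / 2) * (1 - x) ^ (1 - α) / Real.Gamma (2 - α) +
        (a + 1) * (1 - x) ^ (-α) / Real.Gamma (1 - α)) x := by

  have hL : 0 < 1 - x := by linarith [hx.2]
  have h1 : 1 - α ≠ 0 := by linarith [hα.2]
  have h2 : 2 - α ≠ 0 := by linarith [hα.2]
  have hG : Real.Gamma (2 - α) = (1 - α) * Real.Gamma (1 - α) := by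
    rw [show 2 - α = (1 - α) + 1 by ring, Real.Gamma_add_one h1]
  have hG0 : Real.Gamma (1 - α) ≠ 0 := (Real.Gamma_pos_of_pos (by linarith [hα.2])).ne'
  have hd : HasDerivAt (fun y : ℝ => 1 - y) (-1) x := by
    simpa using (hasDerivAt_id x).const_sub 1
  have d1 := hd.rpow_const (p := 2 - α) (Or.inl hL.ne')
  have d2 := hd.rpow_const (p := 1 - α) (Or.inl hL.ne')
  have d := ((((d1.const_mul (-((a + b + 2) / 2))).div_const ((2 - α) * (1 - α))).add
    ((d2.const_mul (a + 1)).div_const (1 - α))).const_mul (1 / Real.Gamma (1 - α))).neg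
  have hev : (fun y => -((1 / Real.Gamma (1 - α)) *
        ∫ s in y..(1 : ℝ), (s - y) ^ (-α) * (((a + b + 2) * s + (a - b)) / 2))) =ᶠ[nhds x]
      (fun y => -((1 / Real.Gamma (1 - α)) *
        (-((a + b + 2) / 2) * (1 - y) ^ (2 - α) / ((2 - α) * (1 - α)) +
          (a + 1) * (1 - y) ^ (1 - α) / (1 - α)))) := by
    filter_upwards [Iio_mem_nhds hx.2] with y hy
    rw [← aux_rl_integral α _ a y hα hy]
    congr 3
    funext s
    ring
  refine HasDerivAt.congr_of_eventuallyEq ?_ hev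
  refine d.congr_deriv ?_
  rw [hG, show 2 - α - 1 = 1 - α by ring, show 1 - α - 1 = -α by ring]
  field_simp
  ring
end
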